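/- arXiv:2109.06156 — 3 statements merged into one kernel-verified Lean document; each statement's English description precedes it below -/
import Mathlib

section
/- Let T > 0, δ ≥ 0, V ≥ 0 and L ≥ 0. For each t ∈ [0,T], let g(·,t), gₙ(·,t) : [0,1] → ℝ be Lebesgue-integrable functions such that g(·,t) has bounded variation with Var(g(·,t)) ≤ V, and let ψ(·,t), ψₙ(·,t) be increasing homeomorphisms of [0,1] such that the inverse of ψ(·,t) is Lipschitz with constant L and the inverse of ψₙ(·,t) is Lipschitz with constant L + δ. Assume that for every t ∈ [0,T]: ∫₀¹ |g(x,t) − gₙ(x,t)| dx ≤ δ and sup_{x∈[0,1]} |ψ(x,t) − ψₙ(x,t)| ≤ δ. Define u(x,t) := g(ψ(x,t),t) and uₙ(x,t) := gₙ(ψₙ(x,t),t). Then sup_{t∈[0,T]} ∫₀¹ |u(x,t) − uₙ(x,t)| dx ≤ L·(V + 1)·δ + δ². -/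
open MeasureTheory Set

/-- Layer-cake estimate for the composition of a monotone function with two monotone maps. -/
lemma core_layer (v p q pi qi : ℝ → ℝ) (V c : ℝ) (hV : 0 ≤ V) (hv : Monotone v)
    (hv0 : ∀ x, 0 ≤ v x) (hv1 : ∀ x, v x ≤ V) (hp : Monotone p) (hq : Monotone q)
    (hpI : ∀ x ∈ Icc (0:ℝ) 1, p x ∈ Icc (0:ℝ) 1) (hqI : ∀ x ∈ Icc (0:ℝ) 1, q x ∈ Icc (0:ℝ) 1)
    (hp1 : ∀ x ∈ Icc (0:ℝ) 1, ∀ y ∈ Icc (0:ℝ) 1, p x ≤ y → x ≤ pi y)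
    (hp2 : ∀ x ∈ Icc (0:ℝ) 1, ∀ y ∈ Icc (0:ℝ) 1, y ≤ p x → pi y ≤ x)
    (hq1 : ∀ x ∈ Icc (0:ℝ) 1, ∀ y ∈ Icc (0:ℝ) 1, q x ≤ y → x ≤ qi y)
    (hq2 : ∀ x ∈ Icc (0:ℝ) 1, ∀ y ∈ Icc (0:ℝ) 1, y ≤ q x → qi y ≤ x)
    (hc : ∀ y ∈ Icc (0:ℝ) 1, |pi y - qi y| ≤ c) :
    ∫⁻ x in Icc (0:ℝ) 1, ENNReal.ofReal |v (p x) - v (q x)| ≤ ENNReal.ofReal (V * c) := by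
  have hG : Measurable (fun x => v (p x)) := (hv.comp hp).measurable
  have hH : Measurable (fun x => v (q x)) := (hv.comp hq).measurable
  set a : ℝ → ℝ := fun x => min (v (p x)) (v (q x)) with ha
  set b : ℝ → ℝ := fun x => max (v (p x)) (v (q x)) with hb
  have ham : Measurable a := hG.min hH
  have hbm : Measurable b := hG.max hH
  have hS := measurableSet_regionBetween ham hbm (measurableSet_Icc (a := (0:ℝ)) (b := 1))
  have h1 := volume_regionBetween_eq_lintegral (μ := volume) ham.aemeasurable hbm.aemeasurable
    (measurableSet_Icc (a := (0:ℝ)) (b := 1))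
  have h2 : ∫⁻ x in Icc (0:ℝ) 1, ENNReal.ofReal |v (p x) - v (q x)|
      = (volume.prod volume) (regionBetween a b (Icc 0 1)) := by
    rw [h1]
    refine lintegral_congr fun x => ?_
    simp only [Pi.sub_apply, ha, hb, max_sub_min_eq_abs']
  rw [h2, Measure.prod_apply_symm hS]
  have key : ∀ s, volume ((fun x => (x, s)) ⁻¹' regionBetween a b (Icc 0 1)) ≤
      (Icc 0 V).indicator (fun _ => ENNReal.ofReal c) s := by
    intro s
    by_cases hne : ((fun x => (x, s)) ⁻¹' regionBetween a b (Icc 0 1)).Nonempty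
    swap
    · rw [Set.not_nonempty_iff_eq_empty] at hne
      rw [hne]; simp
    obtain ⟨x0, hx0, hx1⟩ := hne
    simp only [mem_Ioo, ha, hb, min_lt_iff, lt_max_iff] at hx0 hx1
    have hs : s ∈ Icc 0 V := by
      constructor
      · rcases hx1.1 with h | h
        · exact (hv0 _).trans h.le
        · exact (hv0 _).trans h.le
      · rcases hx1.2 with h | h
        · exact h.le.trans (hv1 _)
        · exact h.le.trans (hv1 _)
    rw [indicator_of_mem hs]
    set Y := {y ∈ Icc (0:ℝ) 1 | v y ≤ s} with hY
    have hYne : Y.Nonempty := by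
      rcases hx1.1 with h | h
      · exact ⟨_, hpI _ hx0, h.le⟩
      · exact ⟨_, hqI _ hx0, h.le⟩
    have hYb : BddAbove Y := ⟨1, fun y hy => hy.1.2⟩
    set y := sSup Y with hy
    have hyI : y ∈ Icc (0:ℝ) 1 := by
      obtain ⟨z, hz⟩ := hYne
      exact ⟨hz.1.1.trans (le_csSup hYb hz), csSup_le ⟨z, hz⟩ fun w hw => hw.1.2⟩
    have hlow : ∀ z ∈ Icc (0:ℝ) 1, v z < s → z ≤ y := fun z hz h => le_csSup hYb ⟨hz, h.le⟩
    have hup : ∀ z ∈ Icc (0:ℝ) 1, s < v z → y ≤ z := by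
      intro z hz h
      refine csSup_le hYne fun w hw => ?_
      by_contra hcon
      push Not at hcon
      exact absurd (hv hcon.le) (by linarith [hw.2])
    have hsub : ((fun x => (x, s)) ⁻¹' regionBetween a b (Icc 0 1)) ⊆ uIcc (qi y) (pi y) := by
      rintro x ⟨hx, hxx⟩
      simp only [mem_Ioo, ha, hb, min_lt_iff, lt_max_iff] at hx hxx
      rw [mem_uIcc]
      rcases hxx.1 with h | h <;> rcases hxx.2 with h' | h'
      · linarith
      · exact Or.inl ⟨hq2 x hx y hyI (hup _ (hqI x hx) h'), hp1 x hx y hyI (hlow _ (hpI x hx) h)⟩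
      · exact Or.inr ⟨hp2 x hx y hyI (hup _ (hpI x hx) h'), hq1 x hx y hyI (hlow _ (hqI x hx) h)⟩
      · linarith
    refine (measure_mono hsub).trans ?_
    rw [Real.volume_interval]
    exact ENNReal.ofReal_le_ofReal (hc y hyI)
  refine (lintegral_mono key).trans ?_
  rw [lintegral_indicator measurableSet_Icc, lintegral_const, Measure.restrict_apply_univ,
    Real.volume_Icc, sub_zero, ENNReal.ofReal_mul hV, mul_comm]

/-- Change of variables inequality for a map with Lipschitz inverse. -/
lemma comp_lintegral_le (f : ℝ → ENNReal) (q qi : ℝ → ℝ) (K : NNReal) (hq : Measurable q)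
    (hqI : ∀ x ∈ Icc (0:ℝ) 1, q x ∈ Icc (0:ℝ) 1)
    (hinv : ∀ x ∈ Icc (0:ℝ) 1, qi (q x) = x)
    (hlip : LipschitzOnWith K qi (Icc 0 1))
    (hf : AEMeasurable f (volume.restrict (Icc 0 1))) :
    ∫⁻ x in Icc (0:ℝ) 1, f (q x) ≤ K * ∫⁻ x in Icc (0:ℝ) 1, f x := by
  have hle : Measure.map q (volume.restrict (Icc (0:ℝ) 1)) ≤
      (K : ENNReal) • volume.restrict (Icc (0:ℝ) 1) := by
    refine Measure.le_iff.2 fun E hE => ?_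
    rw [Measure.map_apply hq hE, Measure.restrict_apply (hq hE), Measure.smul_apply,
      Measure.restrict_apply hE, smul_eq_mul]
    have hsub : q ⁻¹' E ∩ Icc 0 1 ⊆ qi '' (E ∩ Icc 0 1) := fun x hx =>
      ⟨q x, ⟨hx.1, hqI x hx.2⟩, hinv x hx.2⟩
    refine (measure_mono hsub).trans ?_
    have := (hlip.mono (inter_subset_right (s := E))).hausdorffMeasure_image_le
      (d := 1) zero_le_one
    simpa [hausdorffMeasure_real] using this
  have hf' : AEMeasurable f (Measure.map q (volume.restrict (Icc (0:ℝ) 1))) :=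
    AEMeasurable.mono_measure (hf.smul_measure (K : ENNReal)) hle
  rw [← lintegral_map' hf' hq.aemeasurable]
  refine (lintegral_mono' hle le_rfl).trans ?_
  rw [lintegral_smul_measure, smul_eq_mul]


/-- main error bound, Theorem 3.1 of the paper:
For `t ∈ [0,T]`, let `g(·,t), gₙ(·,t) : [0,1] → ℝ` be integrable with `Var(g(·,t)) ≤ V`,
and let `ψ(·,t), ψₙ(·,t)` be increasing homeomorphisms of `[0,1]` whose inverses are
Lipschitz with constants `L` and `L + δ`, respectively.  If for every `t ∈ [0,T]` we have
`∫₀¹ |g − gₙ| ≤ δ` and `sup_x |ψ − ψₙ| ≤ δ`, then with `u := g ∘ ψ` and `uₙ := gₙ ∘ ψₙ`,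
`sup_{t∈[0,T]} ∫₀¹ |u(x,t) − uₙ(x,t)| dx ≤ L (V+1) δ + δ²`. -/
theorem reduced_order_model_error_bound
    (T δ V L : ℝ) (hT : 0 < T) (hδ : 0 ≤ δ) (hV : 0 ≤ V) (hL : 0 ≤ L)
    (g gn ψ ψn ψinv ψninv : ℝ → ℝ → ℝ)
    (hg_int : ∀ t ∈ Icc 0 T, IntegrableOn (fun x => g x t) (Icc 0 1))
    (hgn_int : ∀ t ∈ Icc 0 T, IntegrableOn (fun x => gn x t) (Icc 0 1))
    (hgVar : ∀ t ∈ Icc 0 T, eVariationOn (fun x => g x t) (Icc 0 1) ≤ ENNReal.ofReal V)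
    (hψmono : ∀ t ∈ Icc 0 T, StrictMonoOn (fun x => ψ x t) (Icc 0 1))
    (hψcont : ∀ t ∈ Icc 0 T, ContinuousOn (fun x => ψ x t) (Icc 0 1))
    (hψbij : ∀ t ∈ Icc 0 T, BijOn (fun x => ψ x t) (Icc 0 1) (Icc 0 1))
    (hψinv : ∀ t ∈ Icc 0 T, InvOn (fun y => ψinv y t) (fun x => ψ x t) (Icc 0 1) (Icc 0 1))
    (hψlip : ∀ t ∈ Icc 0 T, LipschitzOnWith (Real.toNNReal L) (fun y => ψinv y t) (Icc 0 1))
    (hψnmono : ∀ t ∈ Icc 0 T, StrictMonoOn (fun x => ψn x t) (Icc 0 1))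
    (hψncont : ∀ t ∈ Icc 0 T, ContinuousOn (fun x => ψn x t) (Icc 0 1))
    (hψnbij : ∀ t ∈ Icc 0 T, BijOn (fun x => ψn x t) (Icc 0 1) (Icc 0 1))
    (hψninv : ∀ t ∈ Icc 0 T, InvOn (fun y => ψninv y t) (fun x => ψn x t) (Icc 0 1) (Icc 0 1))
    (hψnlip : ∀ t ∈ Icc 0 T,
      LipschitzOnWith (Real.toNNReal (L + δ)) (fun y => ψninv y t) (Icc 0 1))
    (hgerr : ∀ t ∈ Icc 0 T, ∫ x in Icc (0:ℝ) 1, |g x t - gn x t| ≤ δ)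
    (hψerr : ∀ t ∈ Icc 0 T, ∀ x ∈ Icc (0:ℝ) 1, |ψ x t - ψn x t| ≤ δ) :
    ∀ t ∈ Icc 0 T,
      ∫ x in Icc (0:ℝ) 1, |g (ψ x t) t - gn (ψn x t) t| ≤ L * (V + 1) * δ + δ ^ 2 := by
  intro t ht
  set cl : ℝ → ℝ := fun x => max 0 (min 1 x) with hcl
  have hclm : Monotone cl := fun x y h => max_le_max le_rfl (min_le_min le_rfl h)
  have hclI : ∀ x, cl x ∈ Icc (0:ℝ) 1 := fun x =>
    ⟨le_max_left _ _, max_le zero_le_one (min_le_left _ _)⟩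
  have hcle : ∀ x ∈ Icc (0:ℝ) 1, cl x = x := fun x hx => by
    simp only [hcl, min_eq_right hx.2, max_eq_right hx.1]
  set p : ℝ → ℝ := fun x => ψ (cl x) t with hp
  set q : ℝ → ℝ := fun x => ψn (cl x) t with hq
  have hpm : Monotone p := fun x y h => (hψmono t ht).monotoneOn (hclI x) (hclI y) (hclm h)
  have hqm : Monotone q := fun x y h => (hψnmono t ht).monotoneOn (hclI x) (hclI y) (hclm h)
  have hpe : ∀ x ∈ Icc (0:ℝ) 1, p x = ψ x t := fun x hx => by simp only [hp, hcle x hx]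
  have hqe : ∀ x ∈ Icc (0:ℝ) 1, q x = ψn x t := fun x hx => by simp only [hq, hcle x hx]
  have hpI : ∀ x, p x ∈ Icc (0:ℝ) 1 := fun x => (hψbij t ht).mapsTo (hclI x)
  have hqI : ∀ x, q x ∈ Icc (0:ℝ) 1 := fun x => (hψnbij t ht).mapsTo (hclI x)
  -- inverses map into the unit interval
  have hpinv : ∀ y ∈ Icc (0:ℝ) 1, ψinv y t ∈ Icc (0:ℝ) 1 ∧ ψ (ψinv y t) t = y := by
    intro y hy
    obtain ⟨x, hx, rfl⟩ := (hψbij t ht).surjOn hy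
    have := (hψinv t ht).1 hx
    simp only at this ⊢
    rw [this]; exact ⟨hx, rfl⟩
  have hqinv : ∀ y ∈ Icc (0:ℝ) 1, ψninv y t ∈ Icc (0:ℝ) 1 ∧ ψn (ψninv y t) t = y := by
    intro y hy
    obtain ⟨x, hx, rfl⟩ := (hψnbij t ht).surjOn hy
    have := (hψninv t ht).1 hx
    simp only at this ⊢
    rw [this]; exact ⟨hx, rfl⟩
  set v : ℝ → ℝ := fun x => (eVariationOn (fun x => g x t) (Icc 0 (cl x))).toReal with hv
  have hsubI : ∀ x, Icc 0 (cl x) ⊆ Icc (0:ℝ) 1 := fun x => Icc_subset_Icc le_rfl (hclI x).2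
  have hfin : ∀ s, s ⊆ Icc (0:ℝ) 1 → eVariationOn (fun x => g x t) s ≤ ENNReal.ofReal V :=
    fun s hs => (eVariationOn.mono _ hs).trans (hgVar t ht)
  have hfin' : ∀ s, s ⊆ Icc (0:ℝ) 1 → eVariationOn (fun x => g x t) s ≠ ⊤ :=
    fun s hs => ne_top_of_le_ne_top ENNReal.ofReal_ne_top (hfin s hs)
  have hvm : Monotone v := fun x y h => ENNReal.toReal_mono (hfin' _ (hsubI y))
    (eVariationOn.mono _ (Icc_subset_Icc le_rfl (hclm h)))
  have hv1 : ∀ x, v x ≤ V := fun x => ENNReal.toReal_le_of_le_ofReal hV (hfin _ (hsubI x))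
  have hgv : ∀ a ∈ Icc (0:ℝ) 1, ∀ b ∈ Icc (0:ℝ) 1, a ≤ b → |g a t - g b t| ≤ |v a - v b| := by
    intro a ha b hb hab
    have h1 := eVariationOn.Icc_add_Icc (fun x => g x t) (s := univ) ha.1 hab (mem_univ a)
    simp only [univ_inter] at h1
    have hs : Icc a b ⊆ Icc (0:ℝ) 1 := Icc_subset_Icc ha.1 hb.2
    have h2 : edist (g a t) (g b t) ≤ eVariationOn (fun x => g x t) (Icc a b) :=
      eVariationOn.edist_le _ (left_mem_Icc.2 hab) (right_mem_Icc.2 hab)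
    have h3 : v b = v a + (eVariationOn (fun x => g x t) (Icc a b)).toReal := by
      simp only [hv, hcle a ha, hcle b hb]
      rw [← h1, ENNReal.toReal_add (hfin' _ (Icc_subset_Icc le_rfl ha.2)) (hfin' _ hs)]
    have h4 : |g a t - g b t| ≤ (eVariationOn (fun x => g x t) (Icc a b)).toReal := by
      rw [← Real.dist_eq, ← ENNReal.toReal_ofReal (dist_nonneg (x := g a t)), ← edist_dist]
      exact ENNReal.toReal_mono (hfin' _ hs) h2
    rw [abs_sub_comm (v a)]
    exact h4.trans (le_trans (by linarith) (le_abs_self _))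
  have hgv' : ∀ a ∈ Icc (0:ℝ) 1, ∀ b ∈ Icc (0:ℝ) 1, |g a t - g b t| ≤ |v a - v b| := by
    intro a ha b hb
    rcases le_total a b with h | h
    · exact hgv a ha b hb h
    · rw [abs_sub_comm, abs_sub_comm (v a)]; exact hgv b hb a ha h
  have A : ∫⁻ x in Icc (0:ℝ) 1, ENNReal.ofReal |v (p x) - v (q x)| ≤
      ENNReal.ofReal (V * (L * δ)) := by
    refine core_layer v p q (fun y => ψinv y t) (fun y => ψninv y t) V (L * δ) hV hvm
      (fun x => ENNReal.toReal_nonneg) hv1 hpm hqm (fun x _ => hpI x) (fun x _ => hqI x)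
      ?_ ?_ ?_ ?_ ?_
    · intro x hx y hy h
      rw [hpe x hx, ← (hpinv y hy).2] at h
      exact ((hψmono t ht).le_iff_le hx (hpinv y hy).1).1 h
    · intro x hx y hy h
      rw [hpe x hx, ← (hpinv y hy).2] at h
      exact ((hψmono t ht).le_iff_le (hpinv y hy).1 hx).1 h
    · intro x hx y hy h
      rw [hqe x hx, ← (hqinv y hy).2] at h
      exact ((hψnmono t ht).le_iff_le hx (hqinv y hy).1).1 h
    · intro x hx y hy h
      rw [hqe x hx, ← (hqinv y hy).2] at h
      exact ((hψnmono t ht).le_iff_le (hqinv y hy).1 hx).1 h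
    · intro y hy
      obtain ⟨hx, hxy⟩ := hqinv y hy
      have h1 := (hψlip t ht).dist_le_mul y hy _ ((hψbij t ht).mapsTo hx)
      have h2 := (hψinv t ht).1 hx
      simp only at h1 h2
      rw [h2, Real.dist_eq, Real.dist_eq, Real.coe_toNNReal L hL] at h1
      refine h1.trans (mul_le_mul_of_nonneg_left ?_ hL)
      have h3 := hψerr t ht _ hx
      rwa [hxy, abs_sub_comm] at h3
  have hint : IntegrableOn (fun x => g x t - gn x t) (Icc 0 1) :=
    (hg_int t ht).sub (hgn_int t ht)
  have B : ∫⁻ x in Icc (0:ℝ) 1, ENNReal.ofReal |g (q x) t - gn (q x) t| ≤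
      ENNReal.ofReal ((L + δ) * δ) := by
    have h := comp_lintegral_le (fun y => ENNReal.ofReal |g y t - gn y t|) q
      (fun y => ψninv y t) (Real.toNNReal (L + δ)) hqm.measurable (fun x _ => hqI x)
      (fun x hx => by rw [hqe x hx]; exact (hψninv t ht).1 hx) (hψnlip t ht)
      hint.abs.aestronglyMeasurable.aemeasurable.ennreal_ofReal
    refine h.trans ?_
    rw [ENNReal.ofReal_mul (by positivity)]
    refine mul_le_mul_right ?_ _
    rw [← ofReal_integral_eq_lintegral_ofReal hint.abs
      (Filter.Eventually.of_forall fun x => abs_nonneg _)]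
    exact ENNReal.ofReal_le_ofReal (hgerr t ht)
  have hvmeas : Measurable fun x => ENNReal.ofReal |v (p x) - v (q x)| := by
    have h1 : Measurable fun x => v (p x) := (hvm.comp hpm).measurable
    have h2 : Measurable fun x => v (q x) := (hvm.comp hqm).measurable
    exact ((h1.sub h2).abs).ennreal_ofReal
  have C : ∫⁻ x in Icc (0:ℝ) 1, ENNReal.ofReal |g (ψ x t) t - gn (ψn x t) t| ≤
      ENNReal.ofReal (L * (V + 1) * δ + δ ^ 2) := by
    calc _ ≤ ∫⁻ x in Icc (0:ℝ) 1, (ENNReal.ofReal |v (p x) - v (q x)| +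
          ENNReal.ofReal |g (q x) t - gn (q x) t|) := by
          refine setLIntegral_mono' measurableSet_Icc fun x hx => ?_
          rw [← ENNReal.ofReal_add (abs_nonneg _) (abs_nonneg _), ← hpe x hx, ← hqe x hx]
          refine ENNReal.ofReal_le_ofReal ?_
          exact (abs_sub_le _ (g (q x) t) _).trans
            (add_le_add (hgv' _ (hpI x) _ (hqI x)) le_rfl)
      _ = _ := lintegral_add_left hvmeas _
      _ ≤ ENNReal.ofReal (V * (L * δ)) + ENNReal.ofReal ((L + δ) * δ) := add_le_add A B
      _ = _ := by
          rw [← ENNReal.ofReal_add (by positivity) (by positivity)]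
          congr 1; ring
  have hR : 0 ≤ L * (V + 1) * δ + δ ^ 2 := by positivity
  have D := norm_integral_le_lintegral_norm (μ := volume.restrict (Icc (0:ℝ) 1))
    (fun x => |g (ψ x t) t - gn (ψn x t) t|)
  simp only [Real.norm_eq_abs, abs_abs] at D
  exact (le_abs_self _).trans (D.trans (ENNReal.toReal_le_of_le_ofReal hR C))
end

section
/- Let g : [0,1] → ℝ have bounded variation with Var(g) ≤ V, and let ψ₁, ψ₂ be increasing homeomorphisms of [0,1] such that the inverse of ψ₁ is Lipschitz with constant L. Then ∫₀¹ |g(ψ₁(x)) − g(ψ₂(x))| dx ≤ L · V · sup_{x∈[0,1]} |ψ₁(x) − ψ₂(x)|. -/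
open MeasureTheory Set

theorem mono_layer_bound (V C : ℝ) (u w : ℝ → ℝ) (hu : Measurable u) (hw : Measurable w)
    (huV : ∀ x, u x ∈ Icc 0 V) (hwV : ∀ x, w x ∈ Icc 0 V)
    (hd : ∀ s, ∀ x ∈ Icc (0:ℝ) 1, ∀ y ∈ Icc (0:ℝ) 1, x ≤ y → s ∈ uIoc (u x) (w x) →
      s ∈ uIoc (u y) (w y) → y - x ≤ C) :
    ∫⁻ x in Icc (0:ℝ) 1, ENNReal.ofReal |u x - w x| ≤ ENNReal.ofReal C * ENNReal.ofReal V := by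
  have hE : MeasurableSet {p : ℝ × ℝ | p.2 ∈ uIoc (u p.1) (w p.1)} := by
    have h1 : Measurable fun p : ℝ × ℝ => min (u p.1) (w p.1) := by fun_prop
    have h2 : Measurable fun p : ℝ × ℝ => max (u p.1) (w p.1) := by fun_prop
    exact (measurableSet_lt h1 measurable_snd).inter (measurableSet_le measurable_snd h2)
  have e1 := Measure.prod_apply (μ := volume.restrict (Icc (0:ℝ) 1)) (ν := (volume : Measure ℝ)) hE
  have e2 := Measure.prod_apply_symm (μ := volume.restrict (Icc (0:ℝ) 1))
    (ν := (volume : Measure ℝ)) hE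
  have e3 : ∀ x, volume (Prod.mk x ⁻¹' {p : ℝ × ℝ | p.2 ∈ uIoc (u p.1) (w p.1)})
      = ENNReal.ofReal |u x - w x| := by
    intro x
    have : Prod.mk x ⁻¹' {p : ℝ × ℝ | p.2 ∈ uIoc (u p.1) (w p.1)} = uIoc (u x) (w x) := rfl
    rw [this, Real.volume_uIoc, abs_sub_comm]
  simp_rw [e3] at e1
  rw [← e1, e2]
  calc _ ≤ ∫⁻ s, (Icc 0 V).indicator (fun _ => ENNReal.ofReal C) s := by
        apply lintegral_mono
        intro s
        have hm : MeasurableSet ((fun x => (x, s)) ⁻¹'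
            {p : ℝ × ℝ | p.2 ∈ uIoc (u p.1) (w p.1)}) := measurable_prodMk_right hE
        beta_reduce
        rw [Measure.restrict_apply hm]
        by_cases hs : s ∈ Icc 0 V
        · rw [indicator_of_mem hs]
          refine (Real.volume_le_diam _).trans (Metric.ediam_le ?_)
          rintro x ⟨hx, hx1⟩ y ⟨hy, hy1⟩
          rw [edist_dist, Real.dist_eq]
          apply ENNReal.ofReal_le_ofReal
          rcases le_total x y with h | h
          · rw [abs_sub_comm, abs_of_nonneg (by linarith)]
            exact hd s x hx1 y hy1 h hx hy
          · rw [abs_of_nonneg (by linarith)]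
            exact hd s y hy1 x hx1 h hy hx
        · rw [indicator_of_notMem hs]
          apply le_of_eq
          convert measure_empty (μ := (volume : Measure ℝ))
          ext x
          simp only [mem_inter_iff, mem_preimage, mem_setOf_eq, mem_empty_iff_false, iff_false]
          rintro ⟨hx, -⟩
          apply hs
          rw [mem_uIoc] at hx
          have := huV x
          have := hwV x
          simp only [mem_Icc] at *
          rcases hx with h | h <;> constructor <;> linarith
    _ = _ := by
        rw [lintegral_indicator measurableSet_Icc, setLIntegral_const, Real.volume_Icc, sub_zero]

/-- If `g : [0,1] → ℝ` has bounded variation `Var(g) ≤ V` and `ψ₁, ψ₂` are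
increasing homeomorphisms of `[0,1]` (continuous, strictly increasing bijections of `[0,1]`
onto itself) such that the inverse of `ψ₁` is Lipschitz with constant `L`, then
`∫₀¹ |g(ψ₁ x) − g(ψ₂ x)| dx ≤ L · V · sup_{x ∈ [0,1]} |ψ₁ x − ψ₂ x|`. -/
theorem composition_stability_L1
    (V L : ℝ) (hV : 0 ≤ V) (hL : 0 ≤ L)
    (g ψ₁ ψ₂ ψ₁inv ψ₂inv : ℝ → ℝ)
    (hgVar : eVariationOn g (Icc 0 1) ≤ ENNReal.ofReal V)
    (hψ₁mono : StrictMonoOn ψ₁ (Icc 0 1))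
    (hψ₁cont : ContinuousOn ψ₁ (Icc 0 1))
    (hψ₁bij : BijOn ψ₁ (Icc 0 1) (Icc 0 1))
    (hψ₁inv : InvOn ψ₁inv ψ₁ (Icc 0 1) (Icc 0 1))
    (hψ₁lip : LipschitzOnWith (Real.toNNReal L) ψ₁inv (Icc 0 1))
    (hψ₂mono : StrictMonoOn ψ₂ (Icc 0 1))
    (hψ₂cont : ContinuousOn ψ₂ (Icc 0 1))
    (hψ₂bij : BijOn ψ₂ (Icc 0 1) (Icc 0 1))
    (hψ₂inv : InvOn ψ₂inv ψ₂ (Icc 0 1) (Icc 0 1)) :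
    ∫ x in Icc (0:ℝ) 1, |g (ψ₁ x) - g (ψ₂ x)| ≤
      L * V * (⨆ x : Icc (0:ℝ) 1, |ψ₁ x - ψ₂ x|) := by
  set D := ⨆ x : Icc (0:ℝ) 1, |ψ₁ x - ψ₂ x| with hD
  have hDle : ∀ x ∈ Icc (0:ℝ) 1, |ψ₁ x - ψ₂ x| ≤ D := by
    intro x hx
    refine le_ciSup (f := fun x : Icc (0:ℝ) 1 => |ψ₁ x - ψ₂ x|) ⟨1, ?_⟩ ⟨x, hx⟩
    rintro _ ⟨y, rfl⟩
    have h1 := hψ₁bij.mapsTo y.2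
    have h2 := hψ₂bij.mapsTo y.2
    rw [mem_Icc] at h1 h2
    exact abs_le.2 ⟨by linarith, by linarith⟩
  have hD0 : 0 ≤ D := (abs_nonneg _).trans (hDle 0 (by simp))
  have hbv : BoundedVariationOn g (Icc 0 1) := ne_top_of_le_ne_top ENNReal.ofReal_ne_top hgVar
  let v : ℝ → ℝ := fun y => (eVariationOn g (Icc 0 y)).toReal
  have hfin : ∀ a ∈ Icc (0:ℝ) 1, ∀ b ∈ Icc (0:ℝ) 1, eVariationOn g (Icc a b) ≠ ⊤ :=
    fun a ha b hb => ne_top_of_le_ne_top hbv (eVariationOn.mono g (Icc_subset_Icc ha.1 hb.2))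
  have h01 : (0:ℝ) ∈ Icc (0:ℝ) 1 := by simp
  have hvmono : MonotoneOn v (Icc 0 1) := fun a ha b hb hab =>
    ENNReal.toReal_mono (hfin 0 h01 b hb) (eVariationOn.mono g (Icc_subset_Icc le_rfl hab))
  have hvV : ∀ a ∈ Icc (0:ℝ) 1, v a ∈ Icc 0 V := fun a ha =>
    ⟨ENNReal.toReal_nonneg, ENNReal.toReal_le_of_le_ofReal hV
      ((eVariationOn.mono g (Icc_subset_Icc le_rfl ha.2)).trans hgVar)⟩
  have hgv : ∀ a ∈ Icc (0:ℝ) 1, ∀ b ∈ Icc (0:ℝ) 1, a ≤ b → |g a - g b| ≤ v b - v a := by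
    intro a ha b hb hab
    have h1 := eVariationOn.Icc_add_Icc g (s := univ) ha.1 hab (mem_univ a)
    simp only [univ_inter] at h1
    have h2 : v b = v a + (eVariationOn g (Icc a b)).toReal := by
      simp only [v]
      rw [← h1, ENNReal.toReal_add (hfin 0 h01 a ha) (hfin a ha b hb)]
    have h3 := eVariationOn.edist_le g (s := Icc a b) (left_mem_Icc.2 hab) (right_mem_Icc.2 hab)
    have h4 := ENNReal.toReal_mono (hfin a ha b hb) h3
    rw [edist_dist, ENNReal.toReal_ofReal dist_nonneg, Real.dist_eq] at h4
    linarith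
  have hgv' : ∀ a ∈ Icc (0:ℝ) 1, ∀ b ∈ Icc (0:ℝ) 1, |g a - g b| ≤ |v a - v b| := by
    intro a ha b hb
    rcases le_total a b with h | h
    · rw [abs_sub_comm (v a)]
      exact (hgv a ha b hb h).trans (le_abs_self _)
    · rw [abs_sub_comm (g a)]
      exact (hgv b hb a ha h).trans (le_abs_self _)
  let c : ℝ → ℝ := fun x => max 0 (min x 1)
  have hc : ∀ x, c x ∈ Icc (0:ℝ) 1 := fun x => ⟨le_max_left _ _, max_le zero_le_one (min_le_right _ _)⟩
  have hcm : Monotone c := fun x y h => max_le_max le_rfl (min_le_min h le_rfl)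
  have hcid : ∀ x ∈ Icc (0:ℝ) 1, c x = x := fun x hx => by
    simp only [c]; rw [min_eq_left hx.2, max_eq_right hx.1]
  let u : ℝ → ℝ := fun x => v (ψ₁ (c x))
  let w : ℝ → ℝ := fun x => v (ψ₂ (c x))
  have hum : Monotone u := fun x y h => hvmono (hψ₁bij.mapsTo (hc x)) (hψ₁bij.mapsTo (hc y))
    (hψ₁mono.monotoneOn (hc x) (hc y) (hcm h))
  have hwm : Monotone w := fun x y h => hvmono (hψ₂bij.mapsTo (hc x)) (hψ₂bij.mapsTo (hc y))
    (hψ₂mono.monotoneOn (hc x) (hc y) (hcm h))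
  have hlip : ∀ x ∈ Icc (0:ℝ) 1, ∀ y ∈ Icc (0:ℝ) 1, x ≤ y → ψ₁ y - ψ₁ x ≤ D → y - x ≤ L * D := by
    intro x hx y hy hxy h
    have h1 := hψ₁lip.dist_le_mul _ (hψ₁bij.mapsTo hy) _ (hψ₁bij.mapsTo hx)
    rw [hψ₁inv.1 hx, hψ₁inv.1 hy, Real.dist_eq, Real.dist_eq, Real.coe_toNNReal L hL,
      abs_of_nonneg (sub_nonneg.2 hxy),
      abs_of_nonneg (sub_nonneg.2 (hψ₁mono.monotoneOn hx hy hxy))] at h1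
    exact h1.trans (mul_le_mul_of_nonneg_left h hL)
  have hvlt : ∀ a ∈ Icc (0:ℝ) 1, ∀ b ∈ Icc (0:ℝ) 1, v a < v b → a ≤ b := by
    intro a ha b hb h
    by_contra hn
    exact absurd (hvmono hb ha (not_le.1 hn).le) (not_le.2 h)
  have key := mono_layer_bound V (L * D) u w hum.measurable hwm.measurable
    (fun x => hvV _ (hψ₁bij.mapsTo (hc x))) (fun x => hvV _ (hψ₂bij.mapsTo (hc x))) (by
      intro s x hx y hy hxy hsx hsy
      apply hlip x hx y hy hxy
      have m1 := hum hxy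
      have m2 := hwm hxy
      simp only [u, w, hcid x hx, hcid y hy] at hsx hsy m1 m2
      have dx := abs_le.1 (hDle x hx)
      have dy := abs_le.1 (hDle y hy)
      rw [mem_uIoc] at hsx hsy
      rcases hsx with h | h
      · have : ψ₁ y ≤ ψ₂ x := by
          apply hvlt _ (hψ₁bij.mapsTo hy) _ (hψ₂bij.mapsTo hx)
          rcases hsy with k | k <;> linarith
        linarith
      · have : ψ₂ y ≤ ψ₁ x := by
          apply hvlt _ (hψ₂bij.mapsTo hy) _ (hψ₁bij.mapsTo hx)
          rcases hsy with k | k <;> linarith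
        linarith)
  have hmeas : Measurable fun x => |u x - w x| := by
    have := hum.measurable
    have := hwm.measurable
    fun_prop
  have hLD : 0 ≤ L * D := mul_nonneg hL hD0
  rw [← ENNReal.ofReal_mul hLD] at key
  have hint : Integrable (fun x => |u x - w x|) (volume.restrict (Icc (0:ℝ) 1)) := by
    refine ⟨hmeas.aestronglyMeasurable, ?_⟩
    rw [hasFiniteIntegral_iff_ofReal (Filter.Eventually.of_forall fun x => abs_nonneg _)]
    exact key.trans_lt ENNReal.ofReal_lt_top
  calc ∫ x in Icc (0:ℝ) 1, |g (ψ₁ x) - g (ψ₂ x)| ≤ ∫ x in Icc (0:ℝ) 1, |u x - w x| := by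
        apply integral_mono_of_nonneg (Filter.Eventually.of_forall fun x => abs_nonneg _) hint
        filter_upwards [ae_restrict_mem measurableSet_Icc] with x hx
        simp only [u, w, hcid x hx]
        exact hgv' _ (hψ₁bij.mapsTo hx) _ (hψ₂bij.mapsTo hx)
    _ ≤ L * D * V := by
        rw [integral_eq_lintegral_of_nonneg_ae (Filter.Eventually.of_forall fun x => abs_nonneg _)
          hmeas.aestronglyMeasurable]
        exact ENNReal.toReal_le_of_le_ofReal (mul_nonneg hLD hV) key
    _ = L * V * D := by ring
end

section
/- Let 0 ≤ c ≤ d ≤ 1 and let ψ₁, ψ₂ be increasing homeomorphisms of [0,1] such that the inverse of ψ₁ is Lipschitz with constant L. Then the Lebesgue measure of the symmetric difference of the sets {x ∈ [0,1] : ψ₁(x) ∈ [c,d]} and {x ∈ [0,1] : ψ₂(x) ∈ [c,d]} is at most 2·L·sup_{x∈[0,1]} |ψ₁(x) − ψ₂(x)|. Equivalently, ∫₀¹ |χ_{[c,d]}(ψ₁(x)) − χ_{[c,d]}(ψ₂(x))| dx ≤ 2·L·sup_{x∈[0,1]} |ψ₁(x) − ψ₂(x)|, where χ_{[c,d]} denotes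 the characteristic function of [c,d]. -/
open MeasureTheory Set

/-- For `0 ≤ c ≤ d ≤ 1` and increasing homeomorphisms `ψ₁, ψ₂` of `[0,1]`
with the inverse of `ψ₁` Lipschitz with constant `L`, the measure of the symmetric
difference of the preimages of `[c,d]`, i.e.
`∫₀¹ |χ_{[c,d]}(ψ₁ x) − χ_{[c,d]}(ψ₂ x)| dx`, is at most
`2 L · sup_{x∈[0,1]} |ψ₁ x − ψ₂ x|`. -/
theorem indicator_composition_stability
    (c d L : ℝ) (hc : 0 ≤ c) (hcd : c ≤ d) (hd : d ≤ 1) (hL : 0 ≤ L)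
    (ψ₁ ψ₂ ψ₁inv ψ₂inv : ℝ → ℝ)
    (hψ₁mono : StrictMonoOn ψ₁ (Icc 0 1))
    (hψ₁cont : ContinuousOn ψ₁ (Icc 0 1))
    (hψ₁bij : BijOn ψ₁ (Icc 0 1) (Icc 0 1))
    (hψ₁inv : InvOn ψ₁inv ψ₁ (Icc 0 1) (Icc 0 1))
    (hψ₁lip : LipschitzOnWith (Real.toNNReal L) ψ₁inv (Icc 0 1))
    (hψ₂mono : StrictMonoOn ψ₂ (Icc 0 1))
    (hψ₂cont : ContinuousOn ψ₂ (Icc 0 1))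
    (hψ₂bij : BijOn ψ₂ (Icc 0 1) (Icc 0 1))
    (hψ₂inv : InvOn ψ₂inv ψ₂ (Icc 0 1) (Icc 0 1)) :
    (volume (symmDiff {x ∈ Icc (0:ℝ) 1 | ψ₁ x ∈ Icc c d} {x ∈ Icc (0:ℝ) 1 | ψ₂ x ∈ Icc c d})).toReal
        ≤ 2 * L * (⨆ x : Icc (0:ℝ) 1, |ψ₁ x - ψ₂ x|) ∧
    ∫ x in Icc (0:ℝ) 1,
        |indicator (Icc c d) (fun _ => (1:ℝ)) (ψ₁ x) - indicator (Icc c d) (fun _ => (1:ℝ)) (ψ₂ x)|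
      ≤ 2 * L * (⨆ x : Icc (0:ℝ) 1, |ψ₁ x - ψ₂ x|) := by
  have key : ∀ t ∈ Icc (0:ℝ) 1, ∃ p ∈ Icc (0:ℝ) 1, ∃ q ∈ Icc (0:ℝ) 1, ψ₁ p = t ∧ ψ₂ q = t ∧
      |q - p| ≤ L * (⨆ x : Icc (0:ℝ) 1, |ψ₁ x - ψ₂ x|) := by
    intro t ht
    obtain ⟨p, hp, hpt⟩ := hψ₁bij.surjOn ht
    obtain ⟨q, hq, hqt⟩ := hψ₂bij.surjOn ht
    refine ⟨p, hp, q, hq, hpt, hqt, ?_⟩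
    have h1 := hψ₁lip.dist_le_mul (ψ₁ q) (hψ₁bij.mapsTo hq) (ψ₁ p) (hψ₁bij.mapsTo hp)
    rw [hψ₁inv.1 hp, hψ₁inv.1 hq, Real.dist_eq, Real.dist_eq, Real.coe_toNNReal L hL, hpt,
      ← hqt] at h1
    have hb : BddAbove (range fun x : Icc (0:ℝ) 1 => |ψ₁ x - ψ₂ x|) := by
      refine ⟨1, ?_⟩
      rintro _ ⟨x, rfl⟩
      have h1 := hψ₁bij.mapsTo x.2
      have h2 := hψ₂bij.mapsTo x.2
      have := h1.1
      have := h1.2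
      have := h2.1
      have := h2.2
      exact abs_le.2 ⟨by linarith, by linarith⟩
    exact h1.trans (mul_le_mul_of_nonneg_left (le_ciSup hb ⟨q, hq⟩) hL)
  obtain ⟨a₁, ha₁, a₂, ha₂, e₁, e₂, hA⟩ := key c ⟨hc, hcd.trans hd⟩
  obtain ⟨b₁, hb₁, b₂, hb₂, f₁, f₂, hB⟩ := key d ⟨hc.trans hcd, hd⟩
  set S := ⨆ x : Icc (0:ℝ) 1, |ψ₁ x - ψ₂ x| with hS
  have hset : ∀ (ψ : ℝ → ℝ) (a b : ℝ), StrictMonoOn ψ (Icc 0 1) → a ∈ Icc (0:ℝ) 1 →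
      b ∈ Icc (0:ℝ) 1 → ψ a = c → ψ b = d → {x ∈ Icc (0:ℝ) 1 | ψ x ∈ Icc c d} = Icc a b := by
    intro ψ a b hm ha hb e f
    ext x
    constructor
    · rintro ⟨hx, h1, h2⟩
      rw [← e] at h1
      rw [← f] at h2
      exact ⟨(hm.le_iff_le ha hx).1 h1, (hm.le_iff_le hx hb).1 h2⟩
    · rintro ⟨h1, h2⟩
      have hx : x ∈ Icc (0:ℝ) 1 := ⟨ha.1.trans h1, h2.trans hb.2⟩
      refine ⟨hx, ?_, ?_⟩
      · rw [← e]
        exact (hm.le_iff_le ha hx).2 h1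
      · rw [← f]
        exact (hm.le_iff_le hx hb).2 h2
  have s₁ := hset ψ₁ a₁ b₁ hψ₁mono ha₁ hb₁ e₁ f₁
  have s₂ := hset ψ₂ a₂ b₂ hψ₂mono ha₂ hb₂ e₂ f₂
  have hsub : symmDiff (Icc a₁ b₁) (Icc a₂ b₂) ⊆ uIcc a₁ a₂ ∪ uIcc b₁ b₂ := by
    intro x hx
    simp only [mem_symmDiff, mem_union, mem_uIcc, mem_Icc] at *
    grind
  have hvol : volume.real (symmDiff (Icc a₁ b₁) (Icc a₂ b₂)) ≤ 2 * L * S := by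
    have hu : ∀ a b : ℝ, volume.real (uIcc a b) = |b - a| := by
      intro a b
      simp [Measure.real]
    have h1 : volume.real (symmDiff (Icc a₁ b₁) (Icc a₂ b₂)) ≤
        volume.real (uIcc a₁ a₂ ∪ uIcc b₁ b₂) :=
      measureReal_mono hsub (isCompact_uIcc.union isCompact_uIcc).measure_lt_top.ne
    have h2 := measureReal_union_le (μ := volume) (uIcc a₁ a₂) (uIcc b₁ b₂)
    rw [hu, hu] at h2
    linarith
  refine ⟨by rw [s₁, s₂]; exact hvol, ?_⟩
  have hmeas : MeasurableSet (symmDiff (Icc a₁ b₁) (Icc a₂ b₂)) :=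
    measurableSet_Icc.symmDiff measurableSet_Icc
  have hfin : volume (symmDiff (Icc a₁ b₁) (Icc a₂ b₂)) ≠ ⊤ :=
    ((measure_mono hsub).trans_lt (isCompact_uIcc.union isCompact_uIcc).measure_lt_top).ne
  have hint : ∫ x in Icc (0:ℝ) 1,
        |indicator (Icc c d) (fun _ => (1:ℝ)) (ψ₁ x) - indicator (Icc c d) (fun _ => (1:ℝ)) (ψ₂ x)|
      = ∫ x in Icc (0:ℝ) 1, indicator (symmDiff (Icc a₁ b₁) (Icc a₂ b₂)) 1 x := by
    refine setIntegral_congr_fun measurableSet_Icc ?_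
    intro x hx
    have m₁ : ψ₁ x ∈ Icc c d ↔ x ∈ Icc a₁ b₁ := by
      rw [← s₁]; exact ⟨fun h => ⟨hx, h⟩, fun h => h.2⟩
    have m₂ : ψ₂ x ∈ Icc c d ↔ x ∈ Icc a₂ b₂ := by
      rw [← s₂]; exact ⟨fun h => ⟨hx, h⟩, fun h => h.2⟩
    by_cases h1 : x ∈ Icc a₁ b₁ <;> by_cases h2 : x ∈ Icc a₂ b₂ <;>
      simp only [indicator, m₁, m₂, h1, h2, mem_symmDiff] <;> norm_num
  rw [hint, integral_indicator_one hmeas]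
  refine le_trans ?_ hvol
  exact ENNReal.toReal_mono hfin (Measure.restrict_apply_le _ _)
end
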